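/- Let n, m be positive integers with n ≥ 2, and let A_1, …, A_m ∈ M_n. The following conditions are equivalent: (a) {A_1, …, A_m} consists of mutually commuting normal matrices; (b) there is a positive integer k with |n/2 − k| ≤ 1 such that W_k(A_1, …, A_m) is polyhedral; (c) there is a Hermitian matrix C ∈ M_n with eigenvalues c_1 ≥ … ≥ c_n satisfying c_k > c_{k+1} for some positive integer k with |n/2 − k| ≤ 1, such that W_C(A_1, …, A_m) is polyhedral; (d) for every Hermitian C ∈ M_n, W_C(A_1, …, A_m) is polyhedral. -/

import Mathlib

open Matrix

/-- The joint `C`-numerical range of a tuple of matrices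
`W_C(A_1, …, A_m) = {(tr(C U*A₁U), …, tr(C U*AₘU)) : U unitary} ⊆ ℂ^m`. -/
noncomputable def jointCNumRange {n m : ℕ} (C : Matrix (Fin n) (Fin n) ℂ)
    (A : Fin m → Matrix (Fin n) (Fin n) ℂ) : Set (Fin m → ℂ) :=
  { p | ∃ U ∈ Matrix.unitaryGroup (Fin n) ℂ, ∀ j, p j = (C * (star U * A j * U)).trace }

/-- The joint `k`-numerical range: the `C`-numerical range with
`C = diag(1, …, 1, 0, …, 0)` having exactly `k` ones. -/
noncomputable def jointKNumRange {n m : ℕ} (k : ℕ)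
    (A : Fin m → Matrix (Fin n) (Fin n) ℂ) : Set (Fin m → ℂ) :=
  jointCNumRange (Matrix.diagonal fun i : Fin n => if (i : ℕ) < k then (1 : ℂ) else 0) A

/-- A subset of a real vector space is polyhedral if it is the convex hull of a finite set. -/
def IsPolyhedral {E : Type*} [AddCommGroup E] [Module ℝ E] (S : Set E) : Prop :=
  ∃ F : Set E, F.Finite ∧ S = convexHull ℝ F

/-- A set of real vectors is closed under transfers if from each of its elements an amount may be
moved from a larger to a smaller coordinate, as long as their order is not reversed. -/
def IsTransferClosed {n : ℕ} (T : Set (Fin n → ℝ)) : Prop :=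
  ∀ x ∈ T, ∀ i j, i ≠ j → ∀ e : ℝ, 0 ≤ e → x j + e ≤ x i - e →
    Function.update (Function.update x i (x i - e)) j (x j + e) ∈ T

/-- A set of vectors is closed under permutations of the coordinates. -/
def IsPermClosed {n : ℕ} (T : Set (Fin n → ℝ)) : Prop :=
  ∀ x ∈ T, ∀ σ : Equiv.Perm (Fin n), x ∘ σ ∈ T

lemma IsTransferClosed.cons_sub_sum_mem {n : ℕ} {T : Set (Fin (n + 1) → ℝ)}
    (hT : IsTransferClosed T) {u : ℝ} {v ε : Fin n → ℝ} (hmem : Fin.cons u v ∈ T)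
    (hε : ∀ j, 0 ≤ ε j) (h : ∀ j, v j + ε j ≤ u - ∑ i, ε i) :
    Fin.cons (u - ∑ i, ε i) (v + ε) ∈ T := by
  have key : ∀ s : Finset (Fin n),
      (Fin.cons (u - ∑ i ∈ s, ε i) (fun j => if j ∈ s then v j + ε j else v j) :
        Fin (n + 1) → ℝ) ∈ T := by
    intro s
    induction s using Finset.induction_on with
    | empty => simpa using hmem
    | insert a s ha ih =>
      have h1 : ∑ i ∈ insert a s, ε i ≤ ∑ i, ε i :=
        Finset.sum_le_univ_sum_of_nonneg hε
      rw [Finset.sum_insert ha] at h1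
      have h2 := hT _ ih 0 a.succ (Fin.succ_ne_zero a).symm (ε a) (hε a) (by
        have := h a
        simp only [Fin.cons_succ, Fin.cons_zero, ha, if_false]
        linarith)
      convert! h2 using 1
      simp only [Fin.cons_succ, Fin.cons_zero, ha, if_false, Fin.update_cons_zero,
        ← Fin.cons_update]
      rw [Finset.sum_insert ha]
      congr 1
      · ring
      · ext j
        by_cases hj : j = a
        · subst hj; simp
        · simp [hj]
  convert! key Finset.univ using 2
  ext j; simp

lemma IsTransferClosed.preimage_cons {n : ℕ} {T : Set (Fin (n + 1) → ℝ)}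
    (hT : IsTransferClosed T) (u : ℝ) :
    IsTransferClosed {v : Fin n → ℝ | (Fin.cons u v : Fin (n + 1) → ℝ) ∈ T} := by
  intro v hv i j hij e he h
  have := hT _ hv i.succ j.succ (by simpa using hij) e he (by simpa using h)
  simpa [← Fin.cons_update] using this

lemma IsPermClosed.preimage_cons {n : ℕ} {T : Set (Fin (n + 1) → ℝ)}
    (hT : IsPermClosed T) (u : ℝ) :
    IsPermClosed {v : Fin n → ℝ | (Fin.cons u v : Fin (n + 1) → ℝ) ∈ T} := by
  intro v hv σ
  have := hT _ hv (Equiv.Perm.decomposeFin.symm (0, σ))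
  simp only [Set.mem_ofPred_eq]
  convert! this using 1
  ext j
  refine Fin.cases ?_ (fun j => ?_) j <;> simp

/-- **Hardy–Littlewood–Pólya**: a set closed under permutations and transfers is closed under
doubly stochastic matrices. -/
theorem doublyStochastic_mulVec_mem {n : ℕ} {T : Set (Fin n → ℝ)} (hT : IsTransferClosed T)
    (hP : IsPermClosed T) {S : Matrix (Fin n) (Fin n) ℝ} (hS : S ∈ doublyStochastic ℝ (Fin n))
    {x : Fin n → ℝ} (hx : x ∈ T) : S *ᵥ x ∈ T := by
  induction n with
  | zero => convert! hx
  | succ n ih =>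
    have core : ∀ (S : Matrix (Fin (n + 1)) (Fin (n + 1)) ℝ) (x : Fin (n + 1) → ℝ),
        S ∈ doublyStochastic ℝ (Fin (n + 1)) → x ∈ T → (∀ i, x i ≤ x 0) →
        (∀ i, (S *ᵥ x) i ≤ (S *ᵥ x) 0) → S *ᵥ x ∈ T := by
      intro S x hS hx hx0 hy0
      obtain ⟨hnn, hrow, hcol⟩ := mem_doublyStochastic_iff_sum.1 hS
      have hrow' : ∀ i, ∑ j : Fin n, S i j.succ = 1 - S i 0 := fun i => by
        have := hrow i; rw [Fin.sum_univ_succ] at this; linarith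
      have hcol' : ∀ j, ∑ i : Fin n, S i.succ j = 1 - S 0 j := fun j => by
        have := hcol j; rw [Fin.sum_univ_succ] at this; linarith
      have hle : S 0 0 ≤ 1 := le_one_of_mem_doublyStochastic hS
      have hzero : S 0 0 = 1 → ∀ j : Fin n, S 0 j.succ = 0 ∧ S j.succ 0 = 0 := by
        intro h j
        have h1 := hrow' 0
        have h2 := hcol' 0
        rw [h, sub_self] at h1 h2
        exact ⟨(Finset.sum_eq_zero_iff_of_nonneg fun _ _ => hnn _ _).1 h1 j (Finset.mem_univ _),
          (Finset.sum_eq_zero_iff_of_nonneg fun _ _ => hnn _ _).1 h2 j (Finset.mem_univ _)⟩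
      let S' : Matrix (Fin n) (Fin n) ℝ := fun i j =>
        S i.succ j.succ + S i.succ 0 * S 0 j.succ / (1 - S 0 0)
      have hfrac : ∀ j : Fin n, S j.succ 0 * (1 - S 0 0) / (1 - S 0 0) = S j.succ 0 := by
        intro j
        by_cases h : S 0 0 = 1
        · simp [(hzero h j).2]
        · field_simp [sub_ne_zero.2 (Ne.symm h)]
      have hfrac' : ∀ j : Fin n, (1 - S 0 0) * S 0 j.succ / (1 - S 0 0) = S 0 j.succ := by
        intro j
        by_cases h : S 0 0 = 1
        · simp [(hzero h j).1]
        · field_simp [sub_ne_zero.2 (Ne.symm h)]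
      have hS' : S' ∈ doublyStochastic ℝ (Fin n) := by
        rw [mem_doublyStochastic_iff_sum]
        refine ⟨fun i j => add_nonneg (hnn _ _) (div_nonneg (mul_nonneg (hnn _ _) (hnn _ _))
          (by linarith)), fun i => ?_, fun j => ?_⟩
        · simp only [S', Finset.sum_add_distrib, ← Finset.sum_div, ← Finset.mul_sum, hrow', hfrac]
          ring
        · simp only [S', Finset.sum_add_distrib, ← Finset.sum_div, ← Finset.sum_mul, hcol', hfrac']
          ring
      have hcons : (Fin.cons (x 0) (S' *ᵥ Fin.tail x) : Fin (n + 1) → ℝ) ∈ T :=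
        ih (hT.preimage_cons (x 0)) (hP.preimage_cons (x 0)) hS'
          (x := Fin.tail x) (by simpa using hx)
      set y := S *ᵥ x with hy
      have hyi : ∀ i, y i = S i 0 * x 0 + ∑ j : Fin n, S i j.succ * x j.succ := fun i => by
        simp [hy, mulVec, dotProduct, Fin.sum_univ_succ]
      let ε : Fin n → ℝ := fun j => S j.succ 0 / (1 - S 0 0) * (x 0 - y 0)
      have hyx : y 0 ≤ x 0 := by
        have : ∑ j, S 0 j * x j ≤ ∑ j, S 0 j * x 0 :=
          Finset.sum_le_sum fun j _ => mul_le_mul_of_nonneg_left (hx0 j) (hnn 0 j)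
        rw [← Finset.sum_mul, hrow, one_mul] at this
        exact this
      have hsum : x 0 - ∑ i, ε i = y 0 := by
        simp only [ε, ← Finset.sum_mul, ← Finset.sum_div, hcol']
        by_cases h : S 0 0 = 1
        · have := hyi 0
          simp only [(hzero h _).1, h] at this
          simp [h, this]
        · rw [div_self (sub_ne_zero.2 (Ne.symm h))]; ring
      have htail : S' *ᵥ Fin.tail x + ε = Fin.tail y := by
        ext j
        have e1 : (S' *ᵥ Fin.tail x) j = (∑ b : Fin n, S j.succ b.succ * x b.succ) +
            S j.succ 0 / (1 - S 0 0) * ∑ b : Fin n, S 0 b.succ * x b.succ := by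
          simp only [mulVec, dotProduct, S', Fin.tail, add_mul, Finset.sum_add_distrib,
            Finset.mul_sum]
          congr 1
          exact Finset.sum_congr rfl fun b _ => by ring
        have e2 := hyi 0
        have e3 := hfrac j
        simp only [Pi.add_apply, e1, ε, Fin.tail, hyi j.succ]
        have e4 : ∑ b : Fin n, S 0 b.succ * x b.succ = y 0 - S 0 0 * x 0 := by linarith
        rw [e4]
        linear_combination x 0 * e3
      have := hT.cons_sub_sum_mem hcons (ε := ε)
        (fun j => mul_nonneg (div_nonneg (hnn _ _) (by linarith)) (by linarith))
        (fun j => by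
          rw [hsum]
          exact (congrFun htail j).le.trans (hy0 j.succ))
      rw [hsum, htail, Fin.cons_self_tail] at this
      exact this
    obtain ⟨a, ha⟩ := Finite.exists_max x
    obtain ⟨b, hb⟩ := Finite.exists_max (S *ᵥ x)
    have e : (S.submatrix (Equiv.swap 0 b) (Equiv.swap 0 a)) *ᵥ (x ∘ Equiv.swap 0 a)
        = (S *ᵥ x) ∘ Equiv.swap 0 b := by
      rw [submatrix_mulVec_equiv]; congr 2; ext; simp
    have h1 := core (S.submatrix (Equiv.swap 0 b) (Equiv.swap 0 a)) (x ∘ Equiv.swap 0 a)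
      (by
        obtain ⟨hnn, hrow, hcol⟩ := mem_doublyStochastic_iff_sum.1 hS
        rw [mem_doublyStochastic_iff_sum]
        refine ⟨fun i j => hnn _ _, fun i => ?_, fun j => ?_⟩
        · exact (Equiv.sum_comp _ _).trans (hrow _)
        · exact (Equiv.sum_comp (Equiv.swap 0 b) fun i => S i (Equiv.swap 0 a j)).trans (hcol _))
      (hP _ hx _) (fun i => by simpa using ha _) (fun i => by rw [e]; simpa using hb _)
    rw [e] at h1
    have h2 := hP _ h1 (Equiv.swap 0 b)
    convert! h2 using 1
    ext; simp

lemma mem_unitaryGroup_iff_dotProduct {n : ℕ} {U : Matrix (Fin n) (Fin n) ℂ} :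
    U ∈ unitaryGroup (Fin n) ℂ ↔ ∀ a b, U a ⬝ᵥ star (U b) = if a = b then 1 else 0 := by
  rw [mem_unitaryGroup_iff, ← Matrix.ext_iff]
  simp only [mul_apply, star_apply, one_apply, dotProduct, Pi.star_apply]

/-- The doubly stochastic matrix of squared moduli of the entries of a complex matrix. -/
def normSqMatrix {n : ℕ} (U : Matrix (Fin n) (Fin n) ℂ) : Matrix (Fin n) (Fin n) ℝ :=
  U.map Complex.normSq

lemma normSqMatrix_mem_doublyStochastic {n : ℕ} {U : Matrix (Fin n) (Fin n) ℂ}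
    (hU : U ∈ unitaryGroup (Fin n) ℂ) : normSqMatrix U ∈ doublyStochastic ℝ (Fin n) := by
  rw [mem_doublyStochastic_iff_sum]
  refine ⟨fun i j => Complex.normSq_nonneg _, fun i => ?_, fun j => ?_⟩
  · have := congrFun₂ (mem_unitaryGroup_iff.1 hU) i i
    simp only [mul_apply, star_apply, one_apply_eq, Complex.star_def, Complex.mul_conj] at this
    exact_mod_cast this
  · have := congrFun₂ (mem_unitaryGroup_iff'.1 hU) j j
    simp only [mul_apply, star_apply, one_apply_eq, Complex.star_def, mul_comm,
      Complex.mul_conj] at this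
    exact_mod_cast this

lemma exists_normSq_eq_one_re_mul_eq_zero (m : ℂ) :
    ∃ ω : ℂ, Complex.normSq ω = 1 ∧ (ω * m).re = 0 := by
  by_cases h : m = 0
  · exact ⟨1, by simp [h]⟩
  · refine ⟨Complex.I * (starRingEnd ℂ m) / (‖m‖ : ℂ), ?_, ?_⟩
    · simp [Complex.normSq_eq_norm_sq, h]
    · have : Complex.I * (starRingEnd ℂ m) / (‖m‖ : ℂ) * m = Complex.I * (‖m‖ : ℂ) := by
        have h' : (‖m‖ : ℂ) ≠ 0 := by simpa using h
        field_simp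
        rw [mul_comm, Complex.mul_conj, Complex.normSq_eq_norm_sq]
        push_cast; ring
      rw [this]; simp

lemma update_rotation_mem_unitaryGroup {n : ℕ} {U : Matrix (Fin n) (Fin n) ℂ}
    (hU : U ∈ unitaryGroup (Fin n) ℂ) {i j : Fin n} (hij : i ≠ j) {α : ℝ} {β : ℂ}
    (h : α ^ 2 + Complex.normSq β = 1) :
    (U.updateRow i ((α : ℂ) • U i + β • U j)).updateRow j
      (-(starRingEnd ℂ β) • U i + (α : ℂ) • U j) ∈ unitaryGroup (Fin n) ℂ := by
  rw [mem_unitaryGroup_iff_dotProduct] at hU ⊢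
  have h' : (α : ℂ) * α + β * starRingEnd ℂ β = 1 := by
    rw [Complex.mul_conj, ← sq]; exact_mod_cast h
  intro a b
  have hji := hij.symm
  by_cases ha : a = j
  · by_cases hb : b = j
    · subst ha hb
      simp [hU, hij, hji]
      linear_combination h'
    · by_cases hb' : b = i
      · subst ha hb'
        simp [hU, hij, hji]
        ring
      · subst ha
        simp [hU, hb, hb', Ne.symm hb, Ne.symm hb']
  · by_cases ha' : a = i
    · by_cases hb : b = j
      · subst ha' hb
        simp [hU, hij, hji]
        ring
      · by_cases hb' : b = i
        · subst ha' hb'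
          simp [hU, hij, hji]
          linear_combination h'
        · subst ha'
          simp [hU, hij, hb, hb', Ne.symm hb, Ne.symm hb']
    · by_cases hb : b = j
      · subst hb
        simp [hU, ha, ha']
      · by_cases hb' : b = i
        · subst hb'
          simp [hU, hij, ha, ha']
        · simp [hU, ha, ha', hb, hb']

/-- The real diagonals of the matrices unitarily similar to `diagonal c`. -/
def unitaryOrbitDiag {n : ℕ} (c : Fin n → ℝ) : Set (Fin n → ℝ) :=
  (fun U => normSqMatrix U *ᵥ c) '' (unitaryGroup (Fin n) ℂ : Set (Matrix (Fin n) (Fin n) ℂ))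

lemma isPermClosed_unitaryOrbitDiag {n : ℕ} (c : Fin n → ℝ) :
    IsPermClosed (unitaryOrbitDiag c) := by
  rintro _ ⟨U, hU, rfl⟩ σ
  refine ⟨U.submatrix σ id, ?_, rfl⟩
  simp only [SetLike.mem_coe, mem_unitaryGroup_iff_dotProduct] at hU ⊢
  intro a b
  have := hU (σ a) (σ b)
  simp only [σ.injective.eq_iff] at this
  exact this

lemma isTransferClosed_unitaryOrbitDiag {n : ℕ} (c : Fin n → ℝ) :
    IsTransferClosed (unitaryOrbitDiag c) := by
  rintro _ ⟨U, hU, rfl⟩ i j hij e he hle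
  set y := normSqMatrix U *ᵥ c with hy
  have hyl : ∀ l, y l = ∑ b, Complex.normSq (U l b) * c b := fun l => rfl
  simp only at hle ⊢
  rcases he.eq_or_lt with rfl | he
  · simpa using ⟨U, hU, rfl⟩
  have hd : 0 < y i - y j := by linarith
  set s := e / (y i - y j) with hs
  have hs0 : 0 ≤ s := by positivity
  have hs1 : s ≤ 1 := by rw [hs, div_le_one hd]; linarith
  have hse : s * (y i - y j) = e := by rw [hs]; field_simp
  obtain ⟨ω, hω, hωm⟩ := exists_normSq_eq_one_re_mul_eq_zero
    (∑ b, (c b : ℂ) * (U j b * starRingEnd ℂ (U i b)))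
  set α := √(1 - s)
  set β := (√s : ℂ) * ω with hβ
  have hα2 : α ^ 2 = 1 - s := Real.sq_sqrt (by linarith)
  have hβ2 : Complex.normSq β = s := by
    rw [hβ, map_mul, hω, Complex.normSq_ofReal, Real.mul_self_sqrt hs0, mul_one]
  have hcross : ∑ b, c b * (α * (β * U j b * starRingEnd ℂ (U i b)).re) = 0 := by
    have : ∑ b, c b * (α * (β * U j b * starRingEnd ℂ (U i b)).re)
        = α * √s * (ω * ∑ b, (c b : ℂ) * (U j b * starRingEnd ℂ (U i b))).re := by
      rw [Finset.mul_sum, Complex.re_sum, Finset.mul_sum]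
      refine Finset.sum_congr rfl fun b _ => ?_
      rw [hβ, show (√s : ℂ) * ω * U j b * starRingEnd ℂ (U i b)
        = (√s : ℂ) * (ω * (U j b * starRingEnd ℂ (U i b))) by ring,
        show ω * ((c b : ℂ) * (U j b * starRingEnd ℂ (U i b)))
        = (c b : ℂ) * (ω * (U j b * starRingEnd ℂ (U i b))) by ring,
        Complex.re_ofReal_mul, Complex.re_ofReal_mul]
      ring
    rw [this, hωm, mul_zero]
  refine ⟨_, update_rotation_mem_unitaryGroup hU hij (α := α) (β := β)
    (by rw [hα2, hβ2]; ring), ?_⟩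
  have ei : ∀ b, Complex.normSq ((α : ℂ) * U i b + β * U j b) = (1 - s) * Complex.normSq (U i b)
      + s * Complex.normSq (U j b) + 2 * (α * (β * U j b * starRingEnd ℂ (U i b)).re) := by
    intro b
    rw [← hα2, ← hβ2]
    simp [Complex.normSq_apply]
    ring
  have ej : ∀ b, Complex.normSq (-(starRingEnd ℂ β) * U i b + (α : ℂ) * U j b)
      = s * Complex.normSq (U i b) + (1 - s) * Complex.normSq (U j b)
      - 2 * (α * (β * U j b * starRingEnd ℂ (U i b)).re) := by
    intro b
    rw [← hα2, ← hβ2]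
    simp [Complex.normSq_apply]
    ring
  ext l
  simp only [normSqMatrix, mulVec, dotProduct, map_apply]
  by_cases hl : l = j
  · subst hl
    simp only [updateRow_self, Pi.add_apply, Pi.smul_apply, smul_eq_mul, ej, Function.update_self]
    have : ∀ b, (s * Complex.normSq (U i b) + (1 - s) * Complex.normSq (U l b)
      - 2 * (α * (β * U l b * starRingEnd ℂ (U i b)).re)) * c b =
        s * (Complex.normSq (U i b) * c b) + (1 - s) * (Complex.normSq (U l b) * c b)
        - 2 * (c b * (α * (β * U l b * starRingEnd ℂ (U i b)).re)) := fun b => by ring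
    simp only [this, Finset.sum_sub_distrib, Finset.sum_add_distrib, ← Finset.mul_sum, hcross,
      ← hyl]
    linarith
  · by_cases hl' : l = i
    · subst hl'
      simp only [updateRow_ne hl, updateRow_self, Pi.add_apply, Pi.smul_apply, smul_eq_mul, ei,
        Function.update_self, Function.update_of_ne hl]
      have : ∀ b, ((1 - s) * Complex.normSq (U l b) + s * Complex.normSq (U j b)
        + 2 * (α * (β * U j b * starRingEnd ℂ (U l b)).re)) * c b =
          (1 - s) * (Complex.normSq (U l b) * c b) + s * (Complex.normSq (U j b) * c b)
          + 2 * (c b * (α * (β * U j b * starRingEnd ℂ (U l b)).re)) := fun b => by ring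
      simp only [this, Finset.sum_add_distrib, ← Finset.mul_sum, hcross, ← hyl]
      linarith
    · simp only [updateRow_ne hl, updateRow_ne hl', Function.update_of_ne hl,
        Function.update_of_ne hl']
      rfl

/-- **Schur–Horn theorem**, in terms of doubly stochastic matrices. -/
theorem unitaryOrbitDiag_eq_image_doublyStochastic {n : ℕ} (c : Fin n → ℝ) :
    unitaryOrbitDiag c =
      (fun S => S *ᵥ c) '' (doublyStochastic ℝ (Fin n) : Set (Matrix (Fin n) (Fin n) ℝ)) := by
  apply Set.Subset.antisymm
  · rintro _ ⟨U, hU, rfl⟩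
    exact ⟨_, normSqMatrix_mem_doublyStochastic hU, rfl⟩
  · rintro _ ⟨S, hS, rfl⟩
    refine doublyStochastic_mulVec_mem (isTransferClosed_unitaryOrbitDiag c)
      (isPermClosed_unitaryOrbitDiag c) hS ⟨1, one_mem _, ?_⟩
    ext l
    simp [normSqMatrix, mulVec, dotProduct, one_apply, apply_ite]

/-- A commuting family of Hermitian matrices is simultaneously unitarily diagonalizable. -/
theorem exists_unitary_eq_diagonal_of_commute {n : ℕ} {ι : Type*}
    {X : ι → Matrix (Fin n) (Fin n) ℂ} (hX : ∀ s, (X s).IsHermitian)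
    (hc : ∀ s t, X s * X t = X t * X s) :
    ∃ V ∈ unitaryGroup (Fin n) ℂ, ∃ d : ι → Fin n → ℂ, ∀ s, X s = V * diagonal (d s) * star V := by
  classical
  have hT : ∀ s, (toEuclideanLin (X s)).IsSymmetric := fun s =>
    isSymmetric_toEuclideanLin_iff.2 (hX s)
  have hC : Pairwise (Function.onFun Commute fun s => toEuclideanLin (X s)) := by
    intro s t _
    have := congrArg toEuclideanLin (hc s t)
    ext v
    simp [← hc s t]
  have hint := LinearMap.IsSymmetric.directSum_isInternal_of_pairwise_commute hT hC
  have horth := LinearMap.IsSymmetric.orthogonalFamily_iInf_eigenspaces hT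
  rw [← DirectSum.isInternal_ne_bot_iff] at hint
  have : Finite {χ : ι → ℂ // ⨅ s, Module.End.eigenspace (toEuclideanLin (X s)) (χ s) ≠ ⊥} :=
    WellFoundedGT.finite_ne_bot_of_iSupIndep horth.independent
  have := Fintype.ofFinite
    {χ : ι → ℂ // ⨅ s, Module.End.eigenspace (toEuclideanLin (X s)) (χ s) ≠ ⊥}
  have horth' := horth.comp (Subtype.val_injective
    (p := fun χ : ι → ℂ => ⨅ s, Module.End.eigenspace (toEuclideanLin (X s)) (χ s) ≠ ⊥))
  have hfin : Module.finrank ℂ (EuclideanSpace ℂ (Fin n)) = n := finrank_euclideanSpace_fin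
  let b := hint.subordinateOrthonormalBasis hfin horth'
  let χ : Fin n → ι → ℂ := fun a => (hint.subordinateOrthonormalBasisIndex hfin a horth').1
  have hb : ∀ a s, X s *ᵥ (b a) = χ a s • (b a : Fin n → ℂ) := by
    intro a s
    have h1 := hint.subordinateOrthonormalBasis_subordinate hfin a horth'
    have h2 := Module.End.mem_eigenspace_iff.1 ((Submodule.mem_iInf _).1 h1 s)
    exact congrArg WithLp.ofLp h2
  let V : Matrix (Fin n) (Fin n) ℂ :=
    (EuclideanSpace.basisFun (Fin n) ℂ).toBasis.toMatrix b.toBasis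
  have hV : V ∈ unitaryGroup (Fin n) ℂ :=
    (EuclideanSpace.basisFun (Fin n) ℂ).toMatrix_orthonormalBasis_mem_unitary b
  refine ⟨V, hV, fun s a => χ a s, fun s => ?_⟩
  have h : X s * V = V * diagonal fun a => χ a s := by
    ext i a
    have := congrFun (hb a s) i
    rw [mul_diagonal]
    exact this.trans (mul_comm _ _)
  rw [← h, mul_assoc, mem_unitaryGroup_iff.1 hV, mul_one]

open scoped ComplexStarModule Matrix.Norms.L2Operator in
/-- A commuting family of normal matrices is simultaneously unitarily diagonalizable. -/
theorem exists_unitary_eq_diagonal_of_commute_normal {n : ℕ} {ι : Type*}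
    {A : ι → Matrix (Fin n) (Fin n) ℂ} (hA : ∀ s, A s * (A s)ᴴ = (A s)ᴴ * A s)
    (hc : ∀ s t, A s * A t = A t * A s) :
    ∃ V ∈ unitaryGroup (Fin n) ℂ, ∃ d : ι → Fin n → ℂ, ∀ s, A s = V * diagonal (d s) * star V := by
  have hn : ∀ s, IsStarNormal (A s) := fun s => ⟨(hA s).symm⟩
  have hstar : ∀ s t, Commute (A s) (star (A t)) := fun s t => (hn t).commute_star_right (hc s t)
  have hparts : ∀ s (y : Matrix (Fin n) (Fin n) ℂ), Commute (A s) y → Commute (star (A s)) y →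
      Commute (ℜ (A s) : Matrix (Fin n) (Fin n) ℂ) y ∧
        Commute (ℑ (A s) : Matrix (Fin n) (Fin n) ℂ) y := by
    intro s y h h'
    rw [realPart_apply_coe, imaginaryPart_apply_coe]
    exact ⟨(h.add_left h').smul_left _, ((h.sub_left h').smul_left _).smul_left _⟩
  have h1 : ∀ s t, Commute (A t) (ℜ (A s) : Matrix (Fin n) (Fin n) ℂ) ∧
      Commute (A t) (ℑ (A s) : Matrix (Fin n) (Fin n) ℂ) := fun s t =>
    (hparts s _ (hc s t) (hstar t s).symm).imp Commute.symm Commute.symm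
  have h2 : ∀ s t, Commute (star (A t)) (ℜ (A s) : Matrix (Fin n) (Fin n) ℂ) ∧
      Commute (star (A t)) (ℑ (A s) : Matrix (Fin n) (Fin n) ℂ) := fun s t =>
    (hparts s _ (hstar s t) (show star (A s) * star (A t) = star (A t) * star (A s) by
      rw [← star_mul, ← star_mul, hc])).imp Commute.symm Commute.symm
  let X : ι ⊕ ι → Matrix (Fin n) (Fin n) ℂ :=
    Sum.elim (fun s => (ℜ (A s) : Matrix (Fin n) (Fin n) ℂ)) (fun s => ℑ (A s))
  obtain ⟨V, hV, d, hd⟩ := exists_unitary_eq_diagonal_of_commute (X := X)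
    (fun s => by
      rcases s with s | s
      · exact (ℜ (A s)).2
      · exact (ℑ (A s)).2)
    (fun s t => by
      rcases s with s | s <;> rcases t with t | t
      · exact (hparts s _ (h1 t s).1 (h2 t s).1).1
      · exact (hparts s _ (h1 t s).2 (h2 t s).2).1
      · exact (hparts s _ (h1 t s).1 (h2 t s).1).2
      · exact (hparts s _ (h1 t s).2 (h2 t s).2).2)
  refine ⟨V, hV, fun s => d (Sum.inl s) + Complex.I • d (Sum.inr s), fun s => ?_⟩
  rw [← realPart_add_I_smul_imaginaryPart (A s)]
  have e1 := hd (Sum.inl s)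
  have e2 := hd (Sum.inr s)
  simp only [X, Sum.elim_inl, Sum.elim_inr] at e1 e2
  rw [e1, e2, show diagonal (d (Sum.inl s) + Complex.I • d (Sum.inr s)) =
    diagonal (d (Sum.inl s)) + Complex.I • diagonal (d (Sum.inr s)) by
      rw [← diagonal_smul, diagonal_add]; rfl, mul_add, add_mul, mul_smul_comm, smul_mul_assoc]

/-- Every Hermitian matrix is unitarily diagonalizable, with its eigenvalues listed in
nonincreasing order. -/
theorem Matrix.IsHermitian.exists_unitary_eq_diagonal_antitone {n : ℕ}
    {H : Matrix (Fin n) (Fin n) ℂ} (hH : H.IsHermitian) :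
    ∃ W ∈ unitaryGroup (Fin n) ℂ, ∃ c : Fin n → ℝ, Antitone c ∧
      H = W * diagonal (fun i => (c i : ℂ)) * star W := by
  obtain ⟨V, hV, d, hd⟩ : ∃ V ∈ unitaryGroup (Fin n) ℂ, ∃ d : Fin n → ℝ,
      H = V * diagonal (fun i => (d i : ℂ)) * star V :=
    ⟨hH.eigenvectorUnitary, hH.eigenvectorUnitary.2, hH.eigenvalues, hH.spectral_theorem⟩
  let e : Equiv.Perm (Fin n) := Tuple.sort fun i => -d i
  have hW : V.submatrix id e ∈ unitaryGroup (Fin n) ℂ := by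
    rw [mem_unitaryGroup_iff] at hV ⊢
    rw [star_eq_conjTranspose, conjTranspose_submatrix, submatrix_mul_equiv]
    simpa [star_eq_conjTranspose] using hV
  refine ⟨_, hW, d ∘ e, fun i j hij => ?_, ?_⟩
  · simpa using Tuple.monotone_sort (fun i => -d i) hij
  · have h1 : diagonal (fun i => (((d ∘ e) i : ℝ) : ℂ)) =
        (diagonal fun i => (d i : ℂ)).submatrix e e := by
      rw [submatrix_diagonal_equiv]; rfl
    rw [h1, star_eq_conjTranspose, conjTranspose_submatrix, submatrix_mul_equiv,
      submatrix_mul_equiv, submatrix_id_id]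
    exact hd

/-- The trace of `diag(c) Y* diag(d) Y` in terms of the squared moduli of the entries of `Y`. -/
lemma trace_diagonal_mul_conj_diagonal {n : ℕ} (c : Fin n → ℝ) (d : Fin n → ℂ)
    (Y : Matrix (Fin n) (Fin n) ℂ) :
    (diagonal (fun i => (c i : ℂ)) * (star Y * diagonal d * Y)).trace =
      ∑ l, d l * ((normSqMatrix Y *ᵥ c) l : ℝ) := by
  have h : ∀ b, (diagonal (fun i => (c i : ℂ)) * (star Y * diagonal d * Y)) b b =
      c b * ∑ l, star (Y l b) * d l * Y l b := fun b => by
    rw [diagonal_mul, mul_apply]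
    simp only [mul_diagonal, star_apply]
  simp only [trace, diag_apply, h, mulVec, dotProduct, normSqMatrix, map_apply,
    Complex.ofReal_sum, Complex.ofReal_mul, Finset.mul_sum]
  rw [Finset.sum_comm]
  refine Finset.sum_congr rfl fun l _ => Finset.sum_congr rfl fun b _ => ?_
  rw [Complex.normSq_eq_conj_mul_self]
  simp only [RCLike.star_def]
  ring

/-- Passing from `C` to a unitarily similar matrix does not change the trace of `C U* A U`, up to
a change of `U`. -/
lemma trace_unitary_conj {n : ℕ} (W D U A : Matrix (Fin n) (Fin n) ℂ) :
    ((W * D * star W) * (star U * A * U)).trace = (D * (star (U * W) * A * (U * W))).trace := by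
  rw [mul_assoc, mul_assoc, trace_mul_comm, star_mul]
  simp only [mul_assoc]

/-- The joint `C`-numerical range of commuting normal matrices is polyhedral. -/
theorem isPolyhedral_jointCNumRange_of_commute_normal {n m : ℕ}
    {A : Fin m → Matrix (Fin n) (Fin n) ℂ} (hA : ∀ i, A i * (A i)ᴴ = (A i)ᴴ * A i)
    (hc : ∀ i j, A i * A j = A j * A i) {C : Matrix (Fin n) (Fin n) ℂ} (hC : C.IsHermitian) :
    IsPolyhedral (jointCNumRange C A) := by
  obtain ⟨V, hV, d, hd⟩ := exists_unitary_eq_diagonal_of_commute_normal hA hc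
  obtain ⟨W, hW, c, -, rfl⟩ := hC.exists_unitary_eq_diagonal_antitone
  let L : Matrix (Fin n) (Fin n) ℝ →ₗ[ℝ] (Fin m → ℂ) :=
    { toFun := fun S j => ∑ l, d j l * ((S *ᵥ c) l : ℝ)
      map_add' := fun S T => by
        ext1 j
        simp [add_mulVec, mul_add, Finset.sum_add_distrib]
      map_smul' := fun r S => by
        ext1 j
        simp [smul_mulVec, Finset.mul_sum, mul_left_comm] }
  have htrace : ∀ U j, (W * diagonal (fun i => (c i : ℂ)) * star W * (star U * A j * U)).trace =
      ∑ l, d j l * ((normSqMatrix (star V * U * W) *ᵥ c) l : ℝ) := by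
    intro U j
    rw [trace_unitary_conj, ← trace_diagonal_mul_conj_diagonal, hd j]
    simp only [star_mul, star_star, mul_assoc]
  have hrange : jointCNumRange (W * diagonal (fun i => (c i : ℂ)) * star W) A =
      L '' (doublyStochastic ℝ (Fin n) : Set (Matrix (Fin n) (Fin n) ℝ)) := by
    ext p
    constructor
    · rintro ⟨U, hU, hp⟩
      refine ⟨normSqMatrix (star V * U * W),
        normSqMatrix_mem_doublyStochastic (mul_mem (mul_mem (Unitary.star_mem hV) hU) hW), ?_⟩
      ext1 j
      rw [hp, htrace]
      rfl
    · rintro ⟨S, hS, rfl⟩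
      have h : S *ᵥ c ∈ unitaryOrbitDiag c := by
        rw [unitaryOrbitDiag_eq_image_doublyStochastic]
        exact ⟨S, hS, rfl⟩
      obtain ⟨Y, hY, hYS⟩ := h
      refine ⟨V * Y * star W, mul_mem (mul_mem hV hY) (Unitary.star_mem hW), fun j => ?_⟩
      have hY' : star V * (V * Y * star W) * W = Y := by
        have h1 : star V * V = 1 := mem_unitaryGroup_iff'.1 hV
        have h2 : star W * W = 1 := mem_unitaryGroup_iff'.1 hW
        rw [mul_assoc V, ← mul_assoc, h1, one_mul, mul_assoc, h2, mul_one]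
      rw [htrace, hY']
      change _ = ∑ l, d j l * (((fun U => normSqMatrix U *ᵥ c) Y l : ℝ) : ℂ)
      rw [hYS]
      rfl
  rw [hrange, doublyStochastic_eq_convexHull_permMatrix, LinearMap.image_convexHull]
  refine ⟨_, Set.Finite.image _ ?_, rfl⟩
  exact Set.finite_range fun σ : Equiv.Perm (Fin n) => σ.permMatrix ℝ

/-- The indicator vector of the first `k` coordinates. -/
def firstOnes (n k : ℕ) : Fin n → ℝ := fun i => if (i : ℕ) < k then 1 else 0

lemma antitone_firstOnes (n k : ℕ) : Antitone (firstOnes n k) := by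
  intro i j hij
  have : (i : ℕ) ≤ j := hij
  simp only [firstOnes]
  split_ifs <;> first | omega | norm_num

lemma sum_firstOnes {n k : ℕ} (hk : k ≤ n) : ∑ i, firstOnes n k i = k := by
  simp only [firstOnes, Finset.sum_boole]
  rw [Fin.card_filter_val_lt, min_eq_right hk]

/-- The termwise sign behind the comparison of weighted sums of an antitone sequence. -/
lemma Antitone.mul_firstOnes_sub_nonneg {n k : ℕ} {l p : Fin n → ℝ} (hl : Antitone l)
    {a : Fin n} (ha : (a : ℕ) + 1 = k) (h0 : ∀ i, 0 ≤ p i) (h1 : ∀ i, p i ≤ 1) (i : Fin n) :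
    0 ≤ (l i - l a) * (firstOnes n k i - p i) := by
  simp only [firstOnes]
  split_ifs with h
  · exact mul_nonneg (sub_nonneg.2 (hl (by rw [Fin.le_def]; omega))) (sub_nonneg.2 (h1 i))
  · exact mul_nonneg_of_nonpos_of_nonpos (sub_nonpos.2 (hl (by rw [Fin.le_def]; omega)))
      (by linarith [h0 i])

lemma sum_sub_mul_firstOnes_sub {n k : ℕ} (hk : k ≤ n) {l p : Fin n → ℝ} (hp : ∑ i, p i = k)
    (x : ℝ) : ∑ i, (l i - x) * (firstOnes n k i - p i) =
      ∑ i, l i * firstOnes n k i - ∑ i, l i * p i := by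
  have h : ∀ i, (l i - x) * (firstOnes n k i - p i) =
      l i * firstOnes n k i - l i * p i - (x * firstOnes n k i - x * p i) := fun i => by ring
  simp only [h, Finset.sum_sub_distrib, ← Finset.mul_sum, hp, sum_firstOnes hk]
  ring

lemma Antitone.sum_mul_le_sum_mul_firstOnes {n k : ℕ} (hk0 : 1 ≤ k) (hk : k ≤ n)
    {l p : Fin n → ℝ} (hl : Antitone l) (h0 : ∀ i, 0 ≤ p i) (h1 : ∀ i, p i ≤ 1)
    (hp : ∑ i, p i = k) : ∑ i, l i * p i ≤ ∑ i, l i * firstOnes n k i := by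
  rw [← sub_nonneg, ← sum_sub_mul_firstOnes_sub hk hp (l ⟨k - 1, by omega⟩)]
  exact Finset.sum_nonneg fun i _ => hl.mul_firstOnes_sub_nonneg (by simp; omega) h0 h1 i

lemma Antitone.eq_one_and_eq_zero_of_sum_le {n k : ℕ} {a : Fin n} (ha : (a : ℕ) + 1 = k)
    {l p : Fin n → ℝ} (hl : Antitone l) (h0 : ∀ i, 0 ≤ p i) (h1 : ∀ i, p i ≤ 1)
    (hp : ∑ i, p i = k) (h : ∑ i, l i * firstOnes n k i ≤ ∑ i, l i * p i) (i : Fin n) :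
    (l a < l i → p i = 1) ∧ (l i < l a → p i = 0) := by
  have hz : ∑ i, (l i - l a) * (firstOnes n k i - p i) = 0 := by
    refine le_antisymm ?_
      (Finset.sum_nonneg fun i _ => hl.mul_firstOnes_sub_nonneg ha h0 h1 i)
    rw [sum_sub_mul_firstOnes_sub (by omega) hp]
    linarith
  have hi := (Finset.sum_eq_zero_iff_of_nonneg fun i _ =>
    hl.mul_firstOnes_sub_nonneg ha h0 h1 i).1 hz i (Finset.mem_univ i)
  constructor
  · intro hlt
    have hia : i < a := hl.reflect_lt hlt
    have : (i : ℕ) < k := by have : (i : ℕ) < a := hia; omega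
    have := (mul_eq_zero.1 hi).resolve_left (by linarith)
    simp only [firstOnes, if_pos ‹(i : ℕ) < k›] at this
    linarith
  · intro hlt
    have hia : a < i := hl.reflect_lt hlt
    have : ¬ (i : ℕ) < k := by have : (a : ℕ) < i := hia; omega
    have := (mul_eq_zero.1 hi).resolve_left (by linarith)
    simp only [firstOnes, if_neg ‹¬ (i : ℕ) < k›] at this
    linarith

/-- Rearrangement inequality for doubly stochastic matrices. -/
lemma Antitone.sum_mul_doublyStochastic_mulVec_le {n : ℕ} {l c : Fin n → ℝ} (hl : Antitone l)
    (hc : Antitone c) {S : Matrix (Fin n) (Fin n) ℝ} (hS : S ∈ doublyStochastic ℝ (Fin n)) :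
    ∑ i, l i * (S *ᵥ c) i ≤ ∑ i, l i * c i := by
  obtain ⟨w, hw0, hw1, rfl⟩ := exists_eq_sum_perm_of_mem_doublyStochastic hS
  have h : ∀ i, ((∑ σ, w σ • Equiv.Perm.permMatrix ℝ σ) *ᵥ c) i = ∑ σ, w σ * c (σ i) := by
    intro i
    rw [sum_mulVec, Finset.sum_apply]
    exact Finset.sum_congr rfl fun σ _ => by
      rw [smul_mulVec, permMatrix_mulVec]; rfl
  simp only [h, Finset.mul_sum]
  rw [Finset.sum_comm]
  calc _ = ∑ σ, w σ * ∑ i, l i * c (σ i) := by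
        simp only [Finset.mul_sum]
        exact Finset.sum_congr rfl fun σ _ => Finset.sum_congr rfl fun i _ => by ring
    _ ≤ ∑ σ, w σ * ∑ i, l i * c i :=
        Finset.sum_le_sum fun σ _ => mul_le_mul_of_nonneg_left
          ((hl.monovary hc).sum_mul_comp_perm_le_sum_mul) (hw0 σ)
    _ = ∑ i, l i * c i := by rw [← Finset.sum_mul, hw1, one_mul]

/-- `P` is a Hermitian projection of rank `k`. -/
structure IsRankProj {n : ℕ} (k : ℕ) (P : Matrix (Fin n) (Fin n) ℂ) : Prop where
  isHermitian : P.IsHermitian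
  mul_self : P * P = P
  trace_eq : P.trace = k

/-- `P` maximizes `Q ↦ tr(QH)` among the Hermitian projections of rank `k`. -/
structure IsTopProj {n : ℕ} (k : ℕ) (H P : Matrix (Fin n) (Fin n) ℂ) : Prop
    extends IsRankProj k P where
  le : ∀ Q, IsRankProj k Q → (Q * H).trace.re ≤ (P * H).trace.re

lemma IsRankProj.conj {n k : ℕ} {P W : Matrix (Fin n) (Fin n) ℂ} (hP : IsRankProj k P)
    (hW : W ∈ unitaryGroup (Fin n) ℂ) : IsRankProj k (W * P * star W) := by
  have h := mem_unitaryGroup_iff'.1 hW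
  refine ⟨?_, ?_, ?_⟩
  · exact isHermitian_mul_mul_conjTranspose W hP.isHermitian
  · rw [show W * P * star W * (W * P * star W) = W * P * (star W * W) * P * star W by
      simp only [mul_assoc], h, mul_one, mul_assoc W, hP.mul_self]
  · rw [trace_mul_comm, ← mul_assoc, h, one_mul, hP.trace_eq]

lemma IsRankProj.one_sub {n k : ℕ} {P : Matrix (Fin n) (Fin n) ℂ} (hk : k ≤ n)
    (hP : IsRankProj k P) : IsRankProj (n - k) (1 - P) := by
  refine ⟨isHermitian_one.sub hP.isHermitian, ?_, ?_⟩
  · rw [sub_mul, mul_sub, mul_sub, hP.mul_self]; simp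
  · rw [trace_sub, hP.trace_eq, Nat.cast_sub hk]; simp

lemma isRankProj_diagonal_firstOnes {n k : ℕ} (hk : k ≤ n) :
    IsRankProj k (diagonal fun i : Fin n => (firstOnes n k i : ℂ)) := by
  refine ⟨?_, ?_, ?_⟩
  · rw [IsHermitian, diagonal_conjTranspose]
    congr 1
    ext i
    simp
  · rw [diagonal_mul_diagonal]
    congr 1
    ext i
    simp only [firstOnes]
    split_ifs <;> simp
  · rw [trace_diagonal, ← Complex.ofReal_sum, sum_firstOnes hk]
    simp

lemma IsTopProj.one_sub {n k : ℕ} {H P : Matrix (Fin n) (Fin n) ℂ} (hk : k ≤ n)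
    (hP : IsTopProj k H P) : IsTopProj (n - k) (-H) (1 - P) := by
  refine ⟨hP.toIsRankProj.one_sub hk, fun Q hQ => ?_⟩
  have := hP.le (1 - Q) (by simpa [Nat.sub_sub_self hk] using hQ.one_sub (Nat.sub_le n k))
  simp only [sub_mul, one_mul, mul_neg, trace_sub, trace_neg, Complex.sub_re,
    Complex.neg_re] at this ⊢
  linarith

lemma IsRankProj.normSq_sum {n k : ℕ} {P : Matrix (Fin n) (Fin n) ℂ} (hP : IsRankProj k P)
    (i : Fin n) : P i i = (∑ j, Complex.normSq (P i j) : ℝ) := by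
  conv_lhs => rw [← hP.mul_self, mul_apply]
  push_cast
  refine Finset.sum_congr rfl fun j _ => ?_
  rw [← hP.isHermitian.apply, Complex.normSq_eq_conj_mul_self, mul_comm]
  simp

lemma IsRankProj.diag_eq_ofReal {n k : ℕ} {P : Matrix (Fin n) (Fin n) ℂ} (hP : IsRankProj k P)
    (i : Fin n) : P i i = (P i i).re := by
  rw [hP.normSq_sum i, Complex.ofReal_re]

lemma IsRankProj.diag_nonneg {n k : ℕ} {P : Matrix (Fin n) (Fin n) ℂ} (hP : IsRankProj k P)
    (i : Fin n) : 0 ≤ (P i i).re := by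
  rw [hP.normSq_sum i, Complex.ofReal_re]
  exact Finset.sum_nonneg fun j _ => Complex.normSq_nonneg _

lemma IsRankProj.diag_le_one {n k : ℕ} {P : Matrix (Fin n) (Fin n) ℂ} (hP : IsRankProj k P)
    (i : Fin n) : (P i i).re ≤ 1 := by
  have h1 : (P i i).re = ∑ j, Complex.normSq (P i j) := by
    conv_lhs => rw [hP.normSq_sum i, Complex.ofReal_re]
  have h2 : Complex.normSq (P i i) ≤ (P i i).re := by
    rw [h1]
    exact Finset.single_le_sum (f := fun j => Complex.normSq (P i j))
      (fun j _ => Complex.normSq_nonneg _) (Finset.mem_univ i)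
  have h3 : Complex.normSq (P i i) = (P i i).re * (P i i).re := by
    rw [hP.diag_eq_ofReal i, Complex.normSq_ofReal, Complex.ofReal_re]
  nlinarith [hP.diag_nonneg i]

lemma IsRankProj.sum_diag {n k : ℕ} {P : Matrix (Fin n) (Fin n) ℂ} (hP : IsRankProj k P) :
    ∑ i, (P i i).re = k := by
  have := congrArg Complex.re hP.trace_eq
  simpa [trace] using this

/-- A diagonal entry of a projection that is `0` or `1` forces its row. -/
lemma IsRankProj.apply_eq_zero {n k : ℕ} {P : Matrix (Fin n) (Fin n) ℂ} (hP : IsRankProj k P)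
    {i : Fin n} (h : (P i i).re = 0) (j : Fin n) : P i j = 0 := by
  rw [hP.normSq_sum i, Complex.ofReal_re,
    Finset.sum_eq_zero_iff_of_nonneg fun j _ => Complex.normSq_nonneg _] at h
  exact Complex.normSq_eq_zero.1 (h j (Finset.mem_univ j))

lemma IsRankProj.apply_eq_one_apply {n k : ℕ} {P : Matrix (Fin n) (Fin n) ℂ}
    (hk : k ≤ n) (hP : IsRankProj k P)
    {i : Fin n} (h : (P i i).re = 1) (j : Fin n) : P i j = (1 : Matrix (Fin n) (Fin n) ℂ) i j := by
  have := (hP.one_sub hk).apply_eq_zero (i := i) (by simp [h]) j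
  exact (sub_eq_zero.1 this).symm

lemma re_trace_mul_conj_diagonal {n : ℕ} (P W : Matrix (Fin n) (Fin n) ℂ) (l : Fin n → ℝ) :
    (P * (W * diagonal (fun i => (l i : ℂ)) * star W)).trace.re =
      ∑ i, l i * ((star W * P * W) i i).re := by
  rw [trace_mul_comm, show W * diagonal (fun i => (l i : ℂ)) * star W * P =
    W * (diagonal (fun i => (l i : ℂ)) * (star W * P)) by simp only [mul_assoc],
    trace_mul_comm, mul_assoc, trace, Complex.re_sum]
  exact Finset.sum_congr rfl fun i _ => by simp [diagonal_mul]

/-- In an eigenbasis of `H`, the rows of a maximizing projection are known, apart from those of a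
single eigenvalue. -/
lemma IsTopProj.apply_eq {n k : ℕ} {P W : Matrix (Fin n) (Fin n) ℂ} {l : Fin n → ℝ}
    (hl : Antitone l) (hW : W ∈ unitaryGroup (Fin n) ℂ)
    (hP : IsTopProj k (W * diagonal (fun i => (l i : ℂ)) * star W) P)
    {a : Fin n} (ha : (a : ℕ) + 1 = k) (i j : Fin n) :
    (l a < l i → (star W * P * W) i j = (1 : Matrix (Fin n) (Fin n) ℂ) i j) ∧
      (l i < l a → (star W * P * W) i j = 0) := by
  have hk : k ≤ n := by omega
  have hP' : IsRankProj k (star W * P * W) := by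
    simpa using hP.toIsRankProj.conj (Unitary.star_mem hW)
  have h := hP.le _ ((isRankProj_diagonal_firstOnes hk).conj hW)
  have hWW := mem_unitaryGroup_iff'.1 hW
  rw [re_trace_mul_conj_diagonal, re_trace_mul_conj_diagonal,
    show star W * (W * diagonal (fun i => (firstOnes n k i : ℂ)) * star W) * W =
      (star W * W) * diagonal (fun i => (firstOnes n k i : ℂ)) * (star W * W) by
        simp only [mul_assoc], hWW, one_mul, mul_one] at h
  simp only [diagonal_apply_eq, Complex.ofReal_re] at h
  have key := hl.eq_one_and_eq_zero_of_sum_le ha (fun i => hP'.diag_nonneg i)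
    (fun i => hP'.diag_le_one i) hP'.sum_diag h i
  exact ⟨fun hi => hP'.apply_eq_one_apply hk (key.1 hi) j, fun hi =>
    hP'.apply_eq_zero (key.2 hi) j⟩

/-- A unitary maximizing `tr(diag(c) U*HU)` yields a maximizing projection of rank `k` whenever
`c` strictly decreases after its `k`-th entry. -/
lemma isTopProj_of_isMaxOn {n k : ℕ} {c : Fin n → ℝ} (hc : Antitone c) {a b : Fin n}
    (ha : (a : ℕ) + 1 = k) (hb : (b : ℕ) = k) (hab : c b < c a)
    {H U : Matrix (Fin n) (Fin n) ℂ} (hH : H.IsHermitian) (hU : U ∈ unitaryGroup (Fin n) ℂ)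
    (hmax : ∀ V ∈ unitaryGroup (Fin n) ℂ,
      (diagonal (fun i => (c i : ℂ)) * (star V * H * V)).trace.re ≤
        (diagonal (fun i => (c i : ℂ)) * (star U * H * U)).trace.re) :
    IsTopProj k H (U * diagonal (fun i => (firstOnes n k i : ℂ)) * star U) := by
  have hk : k ≤ n := by omega
  refine ⟨(isRankProj_diagonal_firstOnes hk).conj hU, fun Q hQ => ?_⟩
  obtain ⟨W, hW, l, hl, rfl⟩ := hH.exists_unitary_eq_diagonal_antitone
  have hWW := mem_unitaryGroup_iff'.1 hW
  have hQ' : IsRankProj k (star W * Q * W) := by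
    simpa using hQ.conj (Unitary.star_mem hW)
  have htr : ∀ (d : Fin n → ℝ) V, (diagonal (fun i => (d i : ℂ)) *
      (star V * (W * diagonal (fun i => (l i : ℂ)) * star W) * V)).trace.re =
      ∑ i, l i * (normSqMatrix (star W * V) *ᵥ d) i := by
    intro d V
    rw [show star V * (W * diagonal (fun i => (l i : ℂ)) * star W) * V =
      star (star W * V) * diagonal (fun i => (l i : ℂ)) * (star W * V) by
        simp only [star_mul, star_star, mul_assoc], trace_diagonal_mul_conj_diagonal]
    simp
  have hS := normSqMatrix_mem_doublyStochastic (mul_mem (Unitary.star_mem hW) hU)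
  have h1 := hmax W hW
  rw [htr, htr, hWW] at h1
  set S := normSqMatrix (star W * U)
  have hone : normSqMatrix (1 : Matrix (Fin n) (Fin n) ℂ) = 1 := by
    ext i j
    by_cases hij : i = j <;> simp [normSqMatrix, one_apply, hij]
  rw [hone, one_mulVec] at h1
  let c' : Fin n → ℝ := c - (c a - c b) • firstOnes n k
  have hc' : Antitone c' := by
    intro i j hij
    simp only [c', Pi.sub_apply, Pi.smul_apply, smul_eq_mul, firstOnes]
    have hij' : (i : ℕ) ≤ j := hij
    have := hc hij
    split_ifs with h2 h3 h3
    · linarith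
    · omega
    · have h4 : c a ≤ c i := hc (by rw [Fin.le_def]; omega)
      have h5 : c j ≤ c b := hc (by rw [Fin.le_def]; omega)
      linarith
    · linarith
  have h2 := hl.sum_mul_doublyStochastic_mulVec_le hc' hS
  have h3 : ∀ i, (S *ᵥ c') i = (S *ᵥ c) i - (c a - c b) * (S *ᵥ firstOnes n k) i := by
    intro i
    simp only [c', mulVec_sub, mulVec_smul, Pi.sub_apply, Pi.smul_apply, smul_eq_mul]
  simp only [h3, c', Pi.sub_apply, Pi.smul_apply, smul_eq_mul, mul_sub, Finset.sum_sub_distrib,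
    mul_left_comm _ (c a - c b), ← Finset.mul_sum] at h2
  have h4 : ∑ i, l i * firstOnes n k i ≤ ∑ i, l i * (S *ᵥ firstOnes n k) i := by
    have h5 : 0 < c a - c b := by linarith
    refine le_of_mul_le_mul_left ?_ h5
    linarith
  have h5 := trace_unitary_conj U (diagonal fun i => (firstOnes n k i : ℂ)) 1
    (W * diagonal (fun i => (l i : ℂ)) * star W)
  simp only [star_one, one_mul, mul_one] at h5
  rw [h5, htr, re_trace_mul_conj_diagonal]
  exact (hl.sum_mul_le_sum_mul_firstOnes (by omega) hk hQ'.diag_nonneg hQ'.diag_le_one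
    hQ'.sum_diag).trans h4

lemma eq_conj_star_conj {n : ℕ} {W : Matrix (Fin n) (Fin n) ℂ} (hW : W ∈ unitaryGroup (Fin n) ℂ)
    (P : Matrix (Fin n) (Fin n) ℂ) : P = W * (star W * P * W) * star W := by
  have h := mem_unitaryGroup_iff.1 hW
  rw [show W * (star W * P * W) * star W = (W * star W) * P * (W * star W) by
    simp only [mul_assoc], h, one_mul, mul_one]

lemma eq_of_star_conj_eq {n : ℕ} {W : Matrix (Fin n) (Fin n) ℂ}
    (hW : W ∈ unitaryGroup (Fin n) ℂ) {P Q : Matrix (Fin n) (Fin n) ℂ}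
    (h : star W * P * W = star W * Q * W) : P = Q := by
  rw [eq_conj_star_conj hW P, h, ← eq_conj_star_conj hW Q]

lemma star_conj_mul {n : ℕ} {W : Matrix (Fin n) (Fin n) ℂ}
    (hW : W ∈ unitaryGroup (Fin n) ℂ) (P Q : Matrix (Fin n) (Fin n) ℂ) :
    star W * (P * Q) * W = (star W * P * W) * (star W * Q * W) := by
  have h := mem_unitaryGroup_iff.1 hW
  rw [show (star W * P * W) * (star W * Q * W) = star W * P * (W * star W) * Q * W by
    simp only [mul_assoc], h, mul_one]
  simp only [mul_assoc]

lemma star_conj_conj {n : ℕ} {W : Matrix (Fin n) (Fin n) ℂ}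
    (hW : W ∈ unitaryGroup (Fin n) ℂ) (D : Matrix (Fin n) (Fin n) ℂ) :
    star W * (W * D * star W) * W = D := by
  simpa using (eq_conj_star_conj (Unitary.star_mem hW) D).symm

/-- A maximizing projection commutes with the matrix. -/
lemma IsTopProj.commute {n k : ℕ} (hk0 : 1 ≤ k) (hk : k ≤ n) {H P : Matrix (Fin n) (Fin n) ℂ}
    (hH : H.IsHermitian) (hP : IsTopProj k H P) : P * H = H * P := by
  obtain ⟨W, hW, l, hl, rfl⟩ := hH.exists_unitary_eq_diagonal_antitone
  have hrow := hP.apply_eq hl hW (a := ⟨k - 1, by omega⟩) (by simp; omega)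
  have hherm : (star W * P * W).IsHermitian := by
    simpa using (hP.toIsRankProj.conj (Unitary.star_mem hW)).isHermitian
  apply eq_of_star_conj_eq hW
  rw [star_conj_mul hW P, star_conj_mul hW _ P, star_conj_conj hW]
  set P' := star W * P * W
  ext i j
  rw [mul_diagonal, diagonal_mul]
  have hoff : ∀ i j, l i ≠ l ⟨k - 1, by omega⟩ → i ≠ j → P' i j = 0 := by
    intro i j hi hij
    rcases lt_or_gt_of_ne hi with h | h
    · exact (hrow i j).2 h
    · rw [(hrow i j).1 h, one_apply_ne hij]
  rcases eq_or_ne i j with rfl | hij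
  · ring
  by_cases hi : l i = l ⟨k - 1, by omega⟩
  · by_cases hj : l j = l ⟨k - 1, by omega⟩
    · rw [hi, hj]; ring
    · rw [← hherm.apply, hoff j i hj hij.symm]; simp
  · rw [hoff i j hi hij]; simp

/-- The difference of two maximizing projections, possibly of different ranks, lives in a single
eigenspace, unless one of the projections is dominated by the other. -/
lemma IsTopProj.exists_mul_sub_eq_smul_or {n k k' : ℕ} (hk0 : 1 ≤ k) (hkk' : k ≤ k') (hk' : k' ≤ n)
    {H P Q : Matrix (Fin n) (Fin n) ℂ} (hH : H.IsHermitian) (hP : IsTopProj k H P)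
    (hQ : IsTopProj k' H Q) :
    (∃ x : ℝ, H * (P - Q) = (x : ℂ) • (P - Q)) ∨ k < k' ∧ P * (1 - Q) = 0 := by
  obtain ⟨W, hW, l, hl, rfl⟩ := hH.exists_unitary_eq_diagonal_antitone
  have hrow := hP.apply_eq hl hW (a := ⟨k - 1, by omega⟩) (by simp; omega)
  have hrow' := hQ.apply_eq hl hW (a := ⟨k' - 1, by omega⟩) (by simp; omega)
  have hherm : (star W * P * W).IsHermitian := by
    simpa using (hP.toIsRankProj.conj (Unitary.star_mem hW)).isHermitian
  set a : Fin n := ⟨k - 1, by omega⟩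
  set b : Fin n := ⟨k' - 1, by omega⟩
  have hab : l b ≤ l a := hl (by rw [Fin.le_def]; simp only [a, b]; omega)
  rcases hab.eq_or_lt with hab | hab
  · refine Or.inl ⟨l a, eq_of_star_conj_eq hW ?_⟩
    rw [star_conj_mul hW, star_conj_conj hW, mul_smul_comm, smul_mul_assoc, mul_sub, sub_mul]
    ext i j
    rw [diagonal_mul, Matrix.smul_apply, Matrix.sub_apply, smul_eq_mul]
    rcases lt_trichotomy (l i) (l a) with h | h | h
    · rw [(hrow i j).2 h, (hrow' i j).2 (by rwa [hab])]; ring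
    · rw [h]
    · rw [(hrow i j).1 h, (hrow' i j).1 (by rwa [hab])]; ring
  · have hkk : k ≠ k' := by
      rintro rfl
      exact lt_irrefl _ hab
    refine Or.inr ⟨by omega, eq_of_star_conj_eq hW ?_⟩
    rw [star_conj_mul hW, mul_sub, sub_mul, mul_one, mem_unitaryGroup_iff'.1 hW, mul_zero, zero_mul]
    ext i j
    rw [mul_apply, Matrix.zero_apply]
    refine Finset.sum_eq_zero fun x _ => ?_
    rcases lt_or_ge (l b) (l x) with h | h
    · rw [Matrix.sub_apply, (hrow' x j).1 h, sub_self, mul_zero]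
    · rw [← hherm.apply, (hrow x i).2 (h.trans_lt hab), star_zero, zero_mul]

lemma IsTopProj.exists_mul_sub_eq_smul {n k : ℕ} (hk0 : 1 ≤ k) (hk : k ≤ n)
    {H P Q : Matrix (Fin n) (Fin n) ℂ} (hH : H.IsHermitian) (hP : IsTopProj k H P)
    (hQ : IsTopProj k H Q) : ∃ x : ℝ, H * (P - Q) = (x : ℂ) • (P - Q) :=
  (hP.exists_mul_sub_eq_smul_or hk0 le_rfl hk hH hQ).resolve_right fun h => lt_irrefl _ h.1

/-- If `D` commutes with `H` and `G` and lives in an eigenspace of a nontrivial combination of `H`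
and `G`, then the commutator of `H` and `G` annihilates `D`. -/
lemma commutator_mul_eq_zero {n : ℕ} {H G D : Matrix (Fin n) (Fin n) ℂ} {a b x : ℝ}
    (hab : a ≠ 0 ∨ b ≠ 0) (hH : D * H = H * D) (hG : D * G = G * D)
    (h : ((a : ℂ) • H + (b : ℂ) • G) * D = (x : ℂ) • D) : (H * G - G * H) * D = 0 := by
  have h1 : (a : ℂ) • (H * D) + (b : ℂ) • (G * D) = (x : ℂ) • D := by
    rw [← h, add_mul, smul_mul_assoc, smul_mul_assoc]
  have h2 := congrArg (fun M => H * M) h1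
  have h3 := congrArg (fun M => M * H) h1
  have h4 := congrArg (fun M => G * M) h1
  have h5 := congrArg (fun M => M * G) h1
  simp only [mul_add, add_mul, mul_smul_comm, smul_mul_assoc, mul_assoc, hH, hG] at h2 h3 h4 h5
  rw [sub_mul, mul_assoc, mul_assoc]
  rcases hab with ha | hb
  · have h6 : (a : ℂ) • (H * (G * D) - G * (H * D)) = 0 := by
      have h7 := h5.trans h4.symm
      rw [smul_sub, sub_eq_zero]
      exact add_right_cancel h7
    exact (smul_eq_zero.1 h6).resolve_left (by exact_mod_cast ha)
  · have h6 : (b : ℂ) • (H * (G * D) - G * (H * D)) = 0 := by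
      have h7 := h2.trans h3.symm
      rw [smul_sub, sub_eq_zero]
      exact add_left_cancel h7
    exact (smul_eq_zero.1 h6).resolve_left (by exact_mod_cast hb)

/-- A function on the members of a finite closed cover of the real line that agrees on
intersecting members is constant on the nonempty members. -/
lemma eq_of_finite_closed_cover {ι α : Type*} [Finite ι] {N : ι → Set ℝ}
    (hN : ∀ v, IsClosed (N v)) (hcover : ∀ t, ∃ v, t ∈ N v) {g : ι → α}
    (hg : ∀ v w t, t ∈ N v → t ∈ N w → g v = g w) {v w : ι} {s t : ℝ} (hs : s ∈ N v)
    (ht : t ∈ N w) : g v = g w := by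
  choose f hf using hcover
  have hloc : IsLocallyConstant (g ∘ f) := by
    intro S
    have h : (g ∘ f ⁻¹' S)ᶜ = ⋃ v ∈ {v | g v ∉ S}, N v := by
      ext x
      simp only [Set.mem_compl_iff, Set.mem_preimage, Function.comp, Set.mem_iUnion,
        Set.mem_ofPred_eq, exists_prop]
      exact ⟨fun hx => ⟨f x, hx, hf x⟩, fun ⟨v, hv, hx⟩ => by rwa [hg _ _ x (hf x) hx]⟩
    rw [← isClosed_compl_iff, h]
    exact (Set.toFinite _).isClosed_biUnion fun v _ => hN v
  calc g v = g (f s) := hg _ _ s hs (hf s)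
    _ = g (f t) := hloc.apply_eq_of_preconnectedSpace s t
    _ = g w := hg _ _ t (hf t) ht

/-- A nonzero traceless Hermitian matrix fixes at most one projection of rank at most two. -/
lemma IsRankProj.eq_of_mul_eq_self {n r : ℕ} (hr : r ≤ 2) (hrn : r ≤ n)
    {X P Q : Matrix (Fin n) (Fin n) ℂ} (hX : X.IsHermitian) (hX0 : X ≠ 0) (htr : X.trace = 0)
    (hP : IsRankProj r P) (hQ : IsRankProj r Q) (hXP : X * P = X) (hXQ : X * Q = X) : P = Q := by
  obtain ⟨W, hW, l, -, rfl⟩ := hX.exists_unitary_eq_diagonal_antitone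
  have hWW := mem_unitaryGroup_iff'.1 hW
  have hsum : ∑ i, l i = 0 := by
    rw [trace_mul_comm, ← mul_assoc, hWW, one_mul, trace_diagonal] at htr
    exact_mod_cast htr
  obtain ⟨a, ha⟩ : ∃ a, l a ≠ 0 := by
    by_contra! h
    exact hX0 (by simp [h])
  obtain ⟨i, j, hi, hj⟩ : ∃ i j, 0 < l i ∧ l j < 0 := by
    obtain ⟨i, -, hi⟩ := Finset.exists_pos_of_sum_zero_of_exists_nonzero l hsum ⟨a, by simp, ha⟩
    obtain ⟨j, -, hj⟩ := Finset.exists_pos_of_sum_zero_of_exists_nonzero (s := Finset.univ)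
      (fun i => -l i) (by simp [hsum]) ⟨a, by simp, neg_ne_zero.2 ha⟩
    exact ⟨i, j, hi, neg_pos.1 hj⟩
  have hij : i ≠ j := by
    rintro rfl
    exact lt_asymm hi hj
  have key : ∀ T, IsRankProj r T →
      W * diagonal (fun i => (l i : ℂ)) * star W * T = W * diagonal (fun i => (l i : ℂ)) * star W →
      ∀ x y, (star W * T * W) x y =
        if x = i ∨ x = j then (1 : Matrix (Fin n) (Fin n) ℂ) x y else 0 := by
    intro T hT hXT x y
    have hT' : IsRankProj r (star W * T * W) := by
      simpa using hT.conj (Unitary.star_mem hW)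
    have h1 := congrArg (fun M => star W * M * W) hXT
    simp only [star_conj_mul hW _ T, star_conj_conj hW] at h1
    have h2 : ∀ x, l x ≠ 0 → (star W * T * W) x x = 1 := by
      intro x hx
      have h3 := congrFun (congrFun h1 x) x
      rw [diagonal_mul, diagonal_apply_eq] at h3
      exact mul_left_cancel₀ (Complex.ofReal_ne_zero.2 hx) (h3.trans (mul_one _).symm)
    split_ifs with hx
    · refine hT'.apply_eq_one_apply hrn ?_ y
      rcases hx with rfl | rfl
      · simp [h2 x hi.ne']
      · simp [h2 x hj.ne]
    · push Not at hx
      refine hT'.apply_eq_zero (le_antisymm ?_ (hT'.diag_nonneg x)) y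
      have h4 := Finset.sum_le_univ_sum_of_nonneg (s := {x, i, j}) hT'.diag_nonneg
      rw [hT'.sum_diag, Finset.sum_insert (by simp [hx.1, hx.2]), Finset.sum_pair hij,
        h2 i hi.ne', h2 j hj.ne] at h4
      have : (r : ℝ) ≤ 2 := by exact_mod_cast hr
      simp only [Complex.one_re] at h4
      linarith
  refine eq_of_star_conj_eq hW ?_
  ext x y
  rw [key P hP hXP, key Q hQ hXQ]

lemma IsRankProj.one_sub_sub {n k : ℕ} (hk : 2 * k ≤ n) {P Q : Matrix (Fin n) (Fin n) ℂ}
    (hP : IsRankProj k P) (hQ : IsRankProj k Q) (hPQ : P * Q = 0) (hQP : Q * P = 0) :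
    IsRankProj (n - 2 * k) (1 - P - Q) := by
  refine ⟨(isHermitian_one.sub hP.isHermitian).sub hQ.isHermitian, ?_, ?_⟩
  · simp only [sub_mul, mul_sub, hP.mul_self, hQ.mul_self, hPQ, hQP, one_mul, mul_one]
    abel
  · rw [trace_sub, trace_sub, hP.trace_eq, hQ.trace_eq, Nat.cast_sub hk]
    simp
    ring

lemma isHermitian_trig {n : ℕ} {H G : Matrix (Fin n) (Fin n) ℂ} (hH : H.IsHermitian)
    (hG : G.IsHermitian) (t : ℝ) :
    ((Real.cos t : ℂ) • H + (Real.sin t : ℂ) • G).IsHermitian := by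
  rw [IsHermitian, conjTranspose_add, conjTranspose_smul, conjTranspose_smul, hH.eq, hG.eq]
  simp only [RCLike.star_def, Complex.conj_ofReal]

/-- If finitely many projections of rank `k`, with `2 * k ≤ n ≤ 2 * k + 2`, that commute with `H`
and `G` suffice to maximize all combinations `cos t • H + sin t • G`, then `H` and `G` commute. -/
theorem commute_of_finite_isTopProj {n k : ℕ} (hk0 : 1 ≤ k) (hk : 2 * k ≤ n) (hk' : n ≤ 2 * k + 2)
    {H G : Matrix (Fin n) (Fin n) ℂ} (hH : H.IsHermitian) (hG : G.IsHermitian)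
    {ι : Type*} [Finite ι] {N : ι → Set ℝ} (hN : ∀ v, IsClosed (N v))
    (hcover : ∀ t, ∃ v, t ∈ N v) {P : ι → Matrix (Fin n) (Fin n) ℂ}
    (hPH : ∀ v, P v * H = H * P v) (hPG : ∀ v, P v * G = G * P v)
    (htop : ∀ v, ∀ t ∈ N v,
      IsTopProj k ((Real.cos t : ℂ) • H + (Real.sin t : ℂ) • G) (P v)) :
    H * G = G * H := by
  by_contra hne
  set R := H * G - G * H with hR
  have hR0 : R ≠ 0 := sub_ne_zero.2 hne
  have hcs : ∀ t : ℝ, Real.cos t ≠ 0 ∨ Real.sin t ≠ 0 := by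
    intro t
    by_contra! h
    have := Real.sin_sq_add_cos_sq t
    rw [h.1, h.2] at this
    norm_num at this
  have hRP : ∀ {v w : ι} {s t : ℝ}, s ∈ N v → t ∈ N w → R * P v = R * P w := by
    refine fun {v w s t} hs ht => eq_of_finite_closed_cover hN hcover (g := fun v => R * P v)
      (fun v w t hv hw => ?_) hs ht
    obtain ⟨x, hx⟩ := (htop v t hv).exists_mul_sub_eq_smul hk0 (by omega)
      (isHermitian_trig hH hG t) (htop w t hw)
    have h := commutator_mul_eq_zero (D := P v - P w) (hcs t)
      (by rw [sub_mul, mul_sub, hPH, hPH]) (by rw [sub_mul, mul_sub, hPG, hPG]) hx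
    rw [← hR, mul_sub, sub_eq_zero] at h
    exact h
  have hopp : ∀ {v w : ι} {t : ℝ}, t ∈ N v → t + Real.pi ∈ N w → P v * P w = 0 := by
    intro v w t hv hw
    have h1 := (htop w _ hw).one_sub (by omega)
    have h2 : -((Real.cos (t + Real.pi) : ℂ) • H + (Real.sin (t + Real.pi) : ℂ) • G) =
        (Real.cos t : ℂ) • H + (Real.sin t : ℂ) • G := by
      rw [Real.cos_add_pi, Real.sin_add_pi]
      push_cast
      rw [neg_smul, neg_smul, neg_add, neg_neg, neg_neg]
    rw [h2] at h1
    rcases (htop v t hv).exists_mul_sub_eq_smul_or hk0 (by omega) (by omega)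
      (isHermitian_trig hH hG t) h1 with
      ⟨x, hx⟩ | ⟨-, h⟩
    · exfalso
      have h := commutator_mul_eq_zero (D := P v - (1 - P w)) (hcs t)
        (by simp only [sub_mul, mul_sub, hPH, one_mul, mul_one])
        (by simp only [sub_mul, mul_sub, hPG, one_mul, mul_one]) hx
      rw [← hR, mul_sub, mul_sub, mul_one, ← hRP hv hw] at h
      have h3 : R = R * P v + R * P v := by
        rw [sub_sub_eq_add_sub, sub_eq_zero] at h
        exact h.symm
      have h4 : R * P v = R * P v + R * P v := by
        have := congrArg (fun M => M * P v) h3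
        simpa only [add_mul, mul_assoc, (htop v t hv).mul_self] using this
      rw [left_eq_add.1 h4, add_zero] at h3
      exact hR0 h3
    · rwa [sub_sub_cancel] at h
  have hopp' : ∀ {v w : ι} {t : ℝ}, t ∈ N v → t + Real.pi ∈ N w → P w * P v = 0 := by
    intro v w t hv hw
    have h := congrArg conjTranspose (hopp hv hw)
    rwa [conjTranspose_mul, (htop v t hv).isHermitian.eq, (htop w _ hw).isHermitian.eq,
      conjTranspose_zero] at h
  have hRP0 : ∀ {v : ι} {t : ℝ}, t ∈ N v → R * P v = 0 := by
    intro v t hv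
    obtain ⟨w, hw⟩ := hcover (t + Real.pi)
    rw [← (htop v t hv).mul_self, ← mul_assoc, hRP hv hw, mul_assoc, hopp' hv hw, mul_zero]
  have hX : (Complex.I • R).IsHermitian := by
    rw [IsHermitian, conjTranspose_smul, hR, conjTranspose_sub, conjTranspose_mul,
      conjTranspose_mul, hH.eq, hG.eq, ← neg_sub, smul_neg, RCLike.star_def, Complex.conj_I,
      neg_smul, neg_neg]
  have hX0 : Complex.I • R ≠ 0 := smul_ne_zero Complex.I_ne_zero hR0
  have hXtr : (Complex.I • R).trace = 0 := by
    rw [trace_smul, hR, trace_sub, trace_mul_comm, sub_self, smul_zero]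
  have huniq : ∀ {v w v' w' : ι} {s t : ℝ}, s ∈ N v → s + Real.pi ∈ N w → t ∈ N v' →
      t + Real.pi ∈ N w' → 1 - P v - P w = 1 - P v' - P w' := by
    intro v w v' w' s t hv hw hv' hw'
    refine IsRankProj.eq_of_mul_eq_self (r := n - 2 * k) (by omega) (by omega) hX hX0 hXtr
      ((htop v s hv).one_sub_sub hk (htop w _ hw).toIsRankProj (hopp hv hw) (hopp' hv hw))
      ((htop v' t hv').one_sub_sub hk (htop w' _ hw').toIsRankProj (hopp hv' hw') (hopp' hv' hw'))
      ?_ ?_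
    · rw [smul_mul_assoc, mul_sub, mul_sub, hRP0 hv, hRP0 hw, mul_one, sub_zero, sub_zero]
    · rw [smul_mul_assoc, mul_sub, mul_sub, hRP0 hv', hRP0 hw', mul_one, sub_zero, sub_zero]
  have hconst : ∀ {v w : ι} {s t : ℝ}, s ∈ N v → t ∈ N w → P v = P w := by
    refine fun {v w s t} hs ht => eq_of_finite_closed_cover hN hcover (g := P)
      (fun v v' t hv hv' => ?_) hs ht
    obtain ⟨w, hw⟩ := hcover (t + Real.pi)
    have h := huniq hv hw hv' hw
    rwa [sub_left_inj, sub_right_inj] at h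
  obtain ⟨v, hv⟩ := hcover 0
  obtain ⟨w, hw⟩ := hcover (0 + Real.pi)
  have h := hopp hv hw
  rw [← hconst hv hw, (htop v _ hv).mul_self] at h
  have htr := (htop v _ hv).trace_eq
  rw [h, trace_zero] at htr
  have : k = 0 := by exact_mod_cast htr.symm
  omega

lemma isClosed_of_forall_trig_le {ι : Type*} (a b : ι → ℝ) (x y : ℝ) (s : Set ι) :
    IsClosed {t : ℝ | ∀ i ∈ s, Real.cos t * a i + Real.sin t * b i ≤
      Real.cos t * x + Real.sin t * y} := by
  simp only [Set.ofPred_forall]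
  exact isClosed_biInter fun i _ => isClosed_le (by fun_prop) (by fun_prop)

/-- Discarding the members of a finite closed cover of the line that are contained in a translate
of `ℤπ` leaves a cover. -/
lemma exists_mem_and_sin_sub_ne_zero {ι : Type*} [Finite ι] {N : ι → Set ℝ}
    (hN : ∀ v, IsClosed (N v)) (hcover : ∀ t, ∃ v, t ∈ N v) (t : ℝ) :
    ∃ v, t ∈ N v ∧ ∃ s ∈ N v, ∃ u ∈ N v, Real.sin (s - u) ≠ 0 := by
  let good : Set ι := {v | ∃ s ∈ N v, ∃ u ∈ N v, Real.sin (s - u) ≠ 0}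
  have hclosed : IsClosed (⋃ v ∈ good, N v) :=
    (Set.toFinite good).isClosed_biUnion fun v _ => hN v
  have hcount : (⋃ v ∈ goodᶜ, N v).Countable := by
    refine (Set.to_countable goodᶜ).biUnion fun v hv => ?_
    rcases (N v).eq_empty_or_nonempty with h | ⟨u, hu⟩
    · simp [h]
    refine (Set.countable_range fun z : ℤ => z * Real.pi + u).mono fun s hs => ?_
    have h : Real.sin (s - u) = 0 := by
      by_contra h
      exact hv ⟨s, hs, u, hu, h⟩
    obtain ⟨z, hz⟩ := Real.sin_eq_zero_iff.1 h
    exact ⟨z, by simp only [hz]; ring⟩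
  have hdense : Dense (⋃ v ∈ good, N v) := by
    refine (hcount.dense_compl ℝ).mono fun x hx => ?_
    obtain ⟨v, hv⟩ := hcover x
    by_cases h : v ∈ good
    · exact Set.mem_biUnion h hv
    · exact absurd (Set.mem_biUnion (show v ∈ goodᶜ from h) hv) hx
  have h : t ∈ ⋃ v ∈ good, N v := by
    rw [← hclosed.closure_eq]
    exact hdense t
  obtain ⟨v, hv, ht⟩ := Set.mem_iUnion₂.1 h
  exact ⟨v, ht, hv⟩

/-- If `P` commutes with two independent combinations of `H` and `G`, it commutes with both. -/
lemma commute_of_commute_trig {n : ℕ} {H G P : Matrix (Fin n) (Fin n) ℂ} {s u : ℝ}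
    (hsu : Real.sin (s - u) ≠ 0)
    (hs : P * ((Real.cos s : ℂ) • H + (Real.sin s : ℂ) • G) =
      ((Real.cos s : ℂ) • H + (Real.sin s : ℂ) • G) * P)
    (hu : P * ((Real.cos u : ℂ) • H + (Real.sin u : ℂ) • G) =
      ((Real.cos u : ℂ) • H + (Real.sin u : ℂ) • G) * P) :
    P * H = H * P ∧ P * G = G * P := by
  rw [mul_add, add_mul, mul_smul_comm, mul_smul_comm, smul_mul_assoc, smul_mul_assoc] at hs hu
  have h : ((Real.sin (s - u) : ℝ) : ℂ) ≠ 0 := Complex.ofReal_ne_zero.2 hsu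
  rw [Real.sin_sub] at h
  constructor <;> refine smul_right_injective _ h ?_ <;> ext i j
  · have h1 := congrFun (congrFun hs i) j
    have h2 := congrFun (congrFun hu i) j
    simp only [Matrix.add_apply, Matrix.smul_apply, smul_eq_mul] at h1 h2 ⊢
    push_cast at h1 h2 ⊢
    linear_combination Complex.sin s * h2 - Complex.sin u * h1
  · have h1 := congrFun (congrFun hs i) j
    have h2 := congrFun (congrFun hu i) j
    simp only [Matrix.add_apply, Matrix.smul_apply, smul_eq_mul] at h1 h2 ⊢
    push_cast at h1 h2 ⊢
    linear_combination Complex.cos u * h1 - Complex.cos s * h2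

lemma re_trace_mul_conj_trig {n : ℕ} (C V H G : Matrix (Fin n) (Fin n) ℂ) (t : ℝ) :
    (C * (star V * ((Real.cos t : ℂ) • H + (Real.sin t : ℂ) • G) * V)).trace.re =
      Real.cos t * (C * (star V * H * V)).trace.re +
        Real.sin t * (C * (star V * G * V)).trace.re := by
  simp only [mul_add, add_mul, mul_smul_comm, smul_mul_assoc, trace_add, trace_smul, smul_eq_mul,
    Complex.add_re, Complex.re_ofReal_mul]

/-- If finitely many unitaries suffice to maximize all functionals
`V ↦ tr(diag(c) V*(cos t • H + sin t • G)V)`, then `H` and `G` commute. -/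
theorem commute_of_finite_maximizers {n k : ℕ} (hk : n ≤ 2 * k + 2) (hk' : 2 * k ≤ n + 2)
    {c : Fin n → ℝ} (hc : Antitone c) {a b : Fin n} (ha : (a : ℕ) + 1 = k) (hb : (b : ℕ) = k)
    (hab : c b < c a) {H G : Matrix (Fin n) (Fin n) ℂ} (hH : H.IsHermitian) (hG : G.IsHermitian)
    {ι : Type*} [Finite ι] {U : ι → Matrix (Fin n) (Fin n) ℂ}
    (hU : ∀ v, U v ∈ unitaryGroup (Fin n) ℂ)
    (hmax : ∀ t : ℝ, ∃ v, ∀ V ∈ unitaryGroup (Fin n) ℂ,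
      Real.cos t * (diagonal (fun i => (c i : ℂ)) * (star V * H * V)).trace.re +
        Real.sin t * (diagonal (fun i => (c i : ℂ)) * (star V * G * V)).trace.re ≤
      Real.cos t * (diagonal (fun i => (c i : ℂ)) * (star (U v) * H * U v)).trace.re +
        Real.sin t * (diagonal (fun i => (c i : ℂ)) * (star (U v) * G * U v)).trace.re) :
    H * G = G * H := by
  let N : ι → Set ℝ := fun v => {t | ∀ V ∈ (unitaryGroup (Fin n) ℂ : Set _),
      Real.cos t * (diagonal (fun i => (c i : ℂ)) * (star V * H * V)).trace.re +
        Real.sin t * (diagonal (fun i => (c i : ℂ)) * (star V * G * V)).trace.re ≤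
      Real.cos t * (diagonal (fun i => (c i : ℂ)) * (star (U v) * H * U v)).trace.re +
        Real.sin t * (diagonal (fun i => (c i : ℂ)) * (star (U v) * G * U v)).trace.re}
  have hN : ∀ v, IsClosed (N v) := fun v => isClosed_of_forall_trig_le _ _ _ _ _
  let P : ι → Matrix (Fin n) (Fin n) ℂ := fun v =>
    U v * diagonal (fun i => (firstOnes n k i : ℂ)) * star (U v)
  have htop : ∀ v, ∀ t ∈ N v,
      IsTopProj k ((Real.cos t : ℂ) • H + (Real.sin t : ℂ) • G) (P v) := by
    intro v t ht
    refine isTopProj_of_isMaxOn hc ha hb hab (isHermitian_trig hH hG t) (hU v) fun V hV => ?_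
    rw [re_trace_mul_conj_trig, re_trace_mul_conj_trig]
    exact ht V hV
  let J := {v // ∃ s ∈ N v, ∃ u ∈ N v, Real.sin (s - u) ≠ 0}
  have hcover : ∀ t, ∃ v : J, t ∈ N v := fun t =>
    let ⟨v, hv, h⟩ := exists_mem_and_sin_sub_ne_zero hN hmax t
    ⟨⟨v, h⟩, hv⟩
  have hcomm : ∀ v : J, P v * H = H * P v ∧ P v * G = G * P v := by
    rintro ⟨v, s, hs, u, hu, hsu⟩
    exact commute_of_commute_trig hsu
      ((htop v s hs).commute (by omega) (by omega) (isHermitian_trig hH hG s))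
      ((htop v u hu).commute (by omega) (by omega) (isHermitian_trig hH hG u))
  rcases le_or_gt (2 * k) n with h | h
  · exact commute_of_finite_isTopProj (N := fun v : J => N v) (P := fun v : J => P v)
      (by omega) h hk hH hG (fun v => hN v) hcover (fun v => (hcomm v).1) (fun v => (hcomm v).2)
      fun v => htop v
  · have key := commute_of_finite_isTopProj (k := n - k) (N := fun v : J => N v)
      (P := fun v : J => 1 - P v) (by omega) (by omega) (by omega) hH.neg hG.neg
      (fun v => hN v) hcover
      (fun v => by rw [mul_neg, neg_mul, sub_mul, mul_sub, (hcomm v).1, one_mul, mul_one])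
      (fun v => by rw [mul_neg, neg_mul, sub_mul, mul_sub, (hcomm v).2, one_mul, mul_one])
      (fun v t ht => by
        rw [smul_neg, smul_neg, ← neg_add]
        exact (htop v t ht).one_sub (by omega))
    rwa [neg_mul_neg, neg_mul_neg] at key

lemma jointCNumRange_conj {n m : ℕ} {W : Matrix (Fin n) (Fin n) ℂ}
    (hW : W ∈ unitaryGroup (Fin n) ℂ) (D : Matrix (Fin n) (Fin n) ℂ)
    (A : Fin m → Matrix (Fin n) (Fin n) ℂ) :
    jointCNumRange (W * D * star W) A = jointCNumRange D A := by
  ext p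
  constructor
  · rintro ⟨U, hU, hp⟩
    exact ⟨U * W, mul_mem hU hW, fun j => by rw [hp, trace_unitary_conj]⟩
  · rintro ⟨U, hU, hp⟩
    refine ⟨U * star W, mul_mem hU (Unitary.star_mem hW), fun j => ?_⟩
    rw [hp, trace_unitary_conj, mul_assoc U, mem_unitaryGroup_iff'.1 hW, mul_one]

lemma Matrix.IsHermitian.trace_mul_im {n : ℕ} {C X : Matrix (Fin n) (Fin n) ℂ}
    (hC : C.IsHermitian) (hX : X.IsHermitian) : (C * X).trace.im = 0 := by
  have h : star (C * X).trace = (C * X).trace := by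
    rw [← trace_conjTranspose, conjTranspose_mul, hC.eq, hX.eq, trace_mul_comm]
  exact Complex.conj_eq_iff_im.1 h

/-- If finitely many points of a set `S` span it as a convex hull, then every linear functional
attains its maximum over `S` at one of them. -/
lemma exists_forall_le_of_eq_convexHull {E : Type*} [AddCommGroup E] [Module ℝ E] {S F : Set E}
    (hF : F.Finite) (hS : S = convexHull ℝ F) (hne : S.Nonempty) (f : E →ₗ[ℝ] ℝ) :
    ∃ p ∈ F, ∀ q ∈ S, f q ≤ f p := by
  rw [hS, convexHull_nonempty_iff] at hne
  obtain ⟨p, hp, hmax⟩ := hF.exists_maximalFor f F hne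
  refine ⟨p, hp, fun q hq => ?_⟩
  rw [hS] at hq
  refine convexHull_min (t := {x | f x ≤ f p}) (fun x hx => ?_)
    (convex_halfSpace_le f.isLinear _) hq
  exact (le_total (f x) (f p)).elim id fun h => hmax hx h

open scoped ComplexStarModule in
/-- The Hermitian and skew-Hermitian parts of a tuple of matrices. -/
noncomputable def hermitianParts {n m : ℕ} (A : Fin m → Matrix (Fin n) (Fin n) ℂ) :
    Fin m ⊕ Fin m → Matrix (Fin n) (Fin n) ℂ :=
  Sum.elim (fun j => (ℜ (A j) : Matrix (Fin n) (Fin n) ℂ)) fun j => ℑ (A j)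

lemma isHermitian_hermitianParts {n m : ℕ} (A : Fin m → Matrix (Fin n) (Fin n) ℂ)
    (s : Fin m ⊕ Fin m) : (hermitianParts A s).IsHermitian := by
  rcases s with j | j
  · exact (realPart (A j)).2
  · exact (imaginaryPart (A j)).2

lemma eq_hermitianParts {n m : ℕ} (A : Fin m → Matrix (Fin n) (Fin n) ℂ) (j : Fin m) :
    A j = hermitianParts A (Sum.inl j) + Complex.I • hermitianParts A (Sum.inr j) :=
  (realPart_add_I_smul_imaginaryPart (A j)).symm

/-- The real and imaginary coordinates on `ℂ^m`. -/
noncomputable def realCoord {m : ℕ} : Fin m ⊕ Fin m → (Fin m → ℂ) →ₗ[ℝ] ℝ :=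
  Sum.elim (fun j => Complex.reLm ∘ₗ LinearMap.proj j) fun j => Complex.imLm ∘ₗ LinearMap.proj j

lemma realCoord_trace {n m : ℕ} {C : Matrix (Fin n) (Fin n) ℂ} (hC : C.IsHermitian)
    (A : Fin m → Matrix (Fin n) (Fin n) ℂ) (U : Matrix (Fin n) (Fin n) ℂ) (s : Fin m ⊕ Fin m) :
    realCoord s (fun j => (C * (star U * A j * U)).trace) =
      (C * (star U * hermitianParts A s * U)).trace.re := by
  have him : ∀ s, (C * (star U * hermitianParts A s * U)).trace.im = 0 := fun s =>
    hC.trace_mul_im (isHermitian_conjTranspose_mul_mul U (isHermitian_hermitianParts A s))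
  have h : ∀ j, (C * (star U * A j * U)).trace =
      (C * (star U * hermitianParts A (Sum.inl j) * U)).trace +
        Complex.I * (C * (star U * hermitianParts A (Sum.inr j) * U)).trace := fun j => by
    rw [eq_hermitianParts A j]
    simp only [mul_add, add_mul, mul_smul_comm, smul_mul_assoc, trace_add, trace_smul, smul_eq_mul]
  rcases s with j | j
  · change (C * (star U * A j * U)).trace.re = _
    rw [h]
    simp [him]
  · change (C * (star U * A j * U)).trace.im = _
    rw [h]
    simp [him]

/-- If the joint `C`-numerical range is polyhedral for a matrix `C` with a gap after the `k`-th
eigenvalue, `k` near `n / 2`, then the matrices are normal and commute. -/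
theorem commute_normal_of_isPolyhedral {n m k : ℕ} (hk : n ≤ 2 * k + 2) (hk' : 2 * k ≤ n + 2)
    {c : Fin n → ℝ} (hc : Antitone c) {a b : Fin n} (ha : (a : ℕ) + 1 = k) (hb : (b : ℕ) = k)
    (hab : c b < c a) {A : Fin m → Matrix (Fin n) (Fin n) ℂ}
    (hpoly : IsPolyhedral (jointCNumRange (diagonal fun i => (c i : ℂ)) A)) :
    (∀ i, A i * (A i)ᴴ = (A i)ᴴ * A i) ∧ ∀ i j, A i * A j = A j * A i := by
  obtain ⟨F, hF, hS⟩ := hpoly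
  have hC : (diagonal fun i => (c i : ℂ)).IsHermitian := by
    rw [IsHermitian, diagonal_conjTranspose]
    congr 1
    ext i
    simp
  have hFS : ∀ p : F, ∃ U ∈ unitaryGroup (Fin n) ℂ,
      ∀ j, p.1 j = (diagonal (fun i => (c i : ℂ)) * (star U * A j * U)).trace := fun p =>
    (hS ▸ subset_convexHull ℝ F :
      F ⊆ jointCNumRange (diagonal fun i => (c i : ℂ)) A) p.2
  choose U hU hp using hFS
  have hcomm : ∀ s u, hermitianParts A s * hermitianParts A u =
      hermitianParts A u * hermitianParts A s := by
    intro s u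
    have := hF.to_subtype
    refine commute_of_finite_maximizers hk hk' hc ha hb hab (isHermitian_hermitianParts A s)
      (isHermitian_hermitianParts A u) hU fun t => ?_
    obtain ⟨p, hpF, hmax⟩ := exists_forall_le_of_eq_convexHull hF hS
      ⟨_, 1, one_mem _, fun _ => rfl⟩ (Real.cos t • realCoord s + Real.sin t • realCoord u)
    refine ⟨⟨p, hpF⟩, fun V hV => ?_⟩
    have h := hmax _ ⟨V, hV, fun _ => rfl⟩
    rw [show p = fun j => _ from funext (hp ⟨p, hpF⟩)] at h
    simpa only [LinearMap.add_apply, LinearMap.smul_apply, smul_eq_mul, realCoord_trace hC] using h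
  have hstar : ∀ j, (A j)ᴴ =
      hermitianParts A (Sum.inl j) - Complex.I • hermitianParts A (Sum.inr j) := by
    intro j
    conv_lhs => rw [eq_hermitianParts A j]
    rw [conjTranspose_add, conjTranspose_smul, (isHermitian_hermitianParts A _).eq,
      (isHermitian_hermitianParts A _).eq, RCLike.star_def, Complex.conj_I, neg_smul,
      sub_eq_add_neg]
  have hC' : ∀ s u, Commute (hermitianParts A s) (hermitianParts A u) := hcomm
  have hA : ∀ s j, Commute (hermitianParts A s) (A j) := fun s j => by
    rw [eq_hermitianParts A j]
    exact (hC' _ _).add_right ((hC' _ _).smul_right _)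
  refine ⟨fun i => ?_, fun i j => ?_⟩
  · rw [hstar]
    exact ((hA _ i).sub_left ((hA _ i).smul_left _)).symm.eq
  · conv_lhs => rw [eq_hermitianParts A i]
    conv_rhs => rw [eq_hermitianParts A i]
    exact ((hA _ j).add_left ((hA _ j).smul_left _)).eq

theorem stmt_6 {n m : ℕ} (hn : 2 ≤ n) (hm : 0 < m)
    (A : Fin m → Matrix (Fin n) (Fin n) ℂ) :
    List.TFAE
      [ -- (a) mutually commuting normal matrices
        (∀ i, A i * (A i)ᴴ = (A i)ᴴ * A i) ∧ (∀ i j, A i * A j = A j * A i),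
        -- (b) some k with |n/2 - k| ≤ 1 such that W_k is polyhedral
        (∃ k : ℕ, 1 ≤ k ∧ k ≤ n - 1 ∧ |(n : ℝ) / 2 - (k : ℝ)| ≤ 1 ∧
          IsPolyhedral (jointKNumRange k A)),
        -- (c) some Hermitian C with eigenvalues c₁ ≥ … ≥ cₙ, c_k > c_{k+1} for
        -- some k with |n/2 - k| ≤ 1, such that W_C is polyhedral
        (∃ (C : Matrix (Fin n) (Fin n) ℂ) (c : Fin n → ℝ),
          Antitone c ∧
          (∃ U ∈ Matrix.unitaryGroup (Fin n) ℂ,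
            C = U * Matrix.diagonal (fun i => (c i : ℂ)) * star U) ∧
          (∃ (j : ℕ) (hj : j + 1 < n),
            c ⟨j, by omega⟩ > c ⟨j + 1, hj⟩ ∧ |(n : ℝ) / 2 - ((j : ℝ) + 1)| ≤ 1) ∧
          IsPolyhedral (jointCNumRange C A)),
        -- (d) W_C is polyhedral for every Hermitian C
        (∀ C : Matrix (Fin n) (Fin n) ℂ, C.IsHermitian →
          IsPolyhedral (jointCNumRange C A)) ] := by
  tfae_have 1 → 4 := fun h C hC => isPolyhedral_jointCNumRange_of_commute_normal h.1 h.2 hC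
  tfae_have 4 → 2 := by
    intro h
    refine ⟨n / 2, by omega, by omega, ?_, h _ ?_⟩
    · have h1 : ((2 * (n / 2) : ℕ) : ℝ) ≤ n := by exact_mod_cast Nat.mul_div_le n 2
      have h2 : (n : ℝ) ≤ (2 * (n / 2) + 1 : ℕ) := by
        exact_mod_cast (by omega : n ≤ 2 * (n / 2) + 1)
      push_cast at h1 h2
      rw [abs_le]
      constructor <;> linarith
    · rw [IsHermitian, diagonal_conjTranspose]
      congr 1
      ext i
      simp only [Pi.star_apply]
      split_ifs <;> simp
  tfae_have 2 → 3 := by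
    rintro ⟨k, hk1, hk2, hk, h⟩
    refine ⟨_, firstOnes n k, antitone_firstOnes n k, ⟨1, one_mem _, ?_⟩,
      ⟨k - 1, by omega, ?_, ?_⟩, h⟩
    · rw [one_mul, star_one, mul_one]
      congr 1
      ext i
      simp only [firstOnes]
      split_ifs <;> simp
    · simp only [firstOnes]
      rw [if_pos (by omega), if_neg (by omega)]
      exact one_pos
    · rw [Nat.cast_sub hk1]
      simpa using hk
  tfae_have 3 → 1 := by
    rintro ⟨C, c, hc, ⟨W, hW, rfl⟩, ⟨j, hj, hlt, habs⟩, hpoly⟩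
    rw [jointCNumRange_conj hW] at hpoly
    rw [abs_le] at habs
    have h1 : (n : ℝ) ≤ (2 * (j + 1) + 2 : ℕ) := by push_cast; linarith [habs.2]
    have h2 : ((2 * (j + 1) : ℕ) : ℝ) ≤ (n + 2 : ℕ) := by push_cast; linarith [habs.1]
    exact commute_normal_of_isPolyhedral (k := j + 1) (by exact_mod_cast h1)
      (by exact_mod_cast h2) hc rfl rfl hlt hpoly
  tfae_finish
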